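/- For any family D of (2D→011)-PI kernels of size (n0,n1)×p2 and any family N of 2D-PI kernels of size p2×m2, there exists a family S of (2D→011)-PI kernels of size (n0,n1)×m2 such that for every continuous u : [a,b]×[c,d] → ℝ^{m2}, P[D](P[N]u) = P[S]u (an equality of triples, holding pointwise in each component). -/

import Mathlib

open Matrix MeasureTheory Set

noncomputable section

/-- A family of 1D-PI kernels of size `p × r` (the parameters of a 1D-PI operator). -/
structure PI1DK (p r : ℕ) where
  k0 : ℝ → Matrix (Fin p) (Fin r) ℝ
  k1 : ℝ → ℝ → Matrix (Fin p) (Fin r) ℝ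
  k2 : ℝ → ℝ → Matrix (Fin p) (Fin r) ℝ

/-- Continuity of a family of 1D-PI kernels on the interval `[s,t]`. -/
def PI1DK.IsCont {p r : ℕ} (s t : ℝ) (N : PI1DK p r) : Prop :=
  ContinuousOn N.k0 (Icc s t) ∧
  ContinuousOn (fun q : ℝ × ℝ => N.k1 q.1 q.2) (Icc s t ×ˢ Icc s t) ∧
  ContinuousOn (fun q : ℝ × ℝ => N.k2 q.1 q.2) (Icc s t ×ˢ Icc s t)

/-- The 1D-PI operator on `[s,t]` associated with the kernels `N`. -/
def PI1D {p r : ℕ} (s t : ℝ) (N : PI1DK p r) (u : ℝ → Fin r → ℝ) (x : ℝ) :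
    Fin p → ℝ :=
  N.k0 x *ᵥ u x + (∫ θ in s..x, N.k1 x θ *ᵥ u θ) + (∫ θ in x..t, N.k2 x θ *ᵥ u θ)

/-- Entrywise interval integral of a matrix-valued function. -/
def mInt {p r : ℕ} (s t : ℝ) (F : ℝ → Matrix (Fin p) (Fin r) ℝ) :
    Matrix (Fin p) (Fin r) ℝ :=
  Matrix.of fun i j => ∫ η in s..t, F η i j

/-- A family of 2D-PI kernels of size `p × r`. -/
structure PI2DK (p r : ℕ) where
  k00 : ℝ → ℝ → Matrix (Fin p) (Fin r) ℝ
  k10 : ℝ → ℝ → ℝ → Matrix (Fin p) (Fin r) ℝ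
  k20 : ℝ → ℝ → ℝ → Matrix (Fin p) (Fin r) ℝ
  k01 : ℝ → ℝ → ℝ → Matrix (Fin p) (Fin r) ℝ
  k02 : ℝ → ℝ → ℝ → Matrix (Fin p) (Fin r) ℝ
  k11 : ℝ → ℝ → ℝ → ℝ → Matrix (Fin p) (Fin r) ℝ
  k21 : ℝ → ℝ → ℝ → ℝ → Matrix (Fin p) (Fin r) ℝ
  k12 : ℝ → ℝ → ℝ → ℝ → Matrix (Fin p) (Fin r) ℝ
  k22 : ℝ → ℝ → ℝ → ℝ → Matrix (Fin p) (Fin r) ℝ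

/-- Continuity of a family of 2D-PI kernels on `[a,b] × [c,d]`. -/
def PI2DK.IsCont {p r : ℕ} (a b c d : ℝ) (N : PI2DK p r) : Prop :=
  ContinuousOn (fun q : ℝ × ℝ => N.k00 q.1 q.2) (Icc a b ×ˢ Icc c d) ∧
  ContinuousOn (fun q : ℝ × ℝ × ℝ => N.k10 q.1 q.2.1 q.2.2)
    (Icc a b ×ˢ Icc c d ×ˢ Icc a b) ∧
  ContinuousOn (fun q : ℝ × ℝ × ℝ => N.k20 q.1 q.2.1 q.2.2)
    (Icc a b ×ˢ Icc c d ×ˢ Icc a b) ∧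
  ContinuousOn (fun q : ℝ × ℝ × ℝ => N.k01 q.1 q.2.1 q.2.2)
    (Icc a b ×ˢ Icc c d ×ˢ Icc c d) ∧
  ContinuousOn (fun q : ℝ × ℝ × ℝ => N.k02 q.1 q.2.1 q.2.2)
    (Icc a b ×ˢ Icc c d ×ˢ Icc c d) ∧
  ContinuousOn (fun q : ℝ × ℝ × ℝ × ℝ => N.k11 q.1 q.2.1 q.2.2.1 q.2.2.2)
    (Icc a b ×ˢ Icc c d ×ˢ Icc a b ×ˢ Icc c d) ∧
  ContinuousOn (fun q : ℝ × ℝ × ℝ × ℝ => N.k21 q.1 q.2.1 q.2.2.1 q.2.2.2)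
    (Icc a b ×ˢ Icc c d ×ˢ Icc a b ×ˢ Icc c d) ∧
  ContinuousOn (fun q : ℝ × ℝ × ℝ × ℝ => N.k12 q.1 q.2.1 q.2.2.1 q.2.2.2)
    (Icc a b ×ˢ Icc c d ×ˢ Icc a b ×ˢ Icc c d) ∧
  ContinuousOn (fun q : ℝ × ℝ × ℝ × ℝ => N.k22 q.1 q.2.1 q.2.2.1 q.2.2.2)
    (Icc a b ×ˢ Icc c d ×ˢ Icc a b ×ˢ Icc c d)

/-- The 2D-PI operator on `[a,b] × [c,d]` associated with the kernels `N`. -/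
def PI2D {p r : ℕ} (a b c d : ℝ) (N : PI2DK p r) (u : ℝ → ℝ → Fin r → ℝ)
    (x y : ℝ) : Fin p → ℝ :=
  N.k00 x y *ᵥ u x y
  + (∫ θ in a..x, N.k10 x y θ *ᵥ u θ y)
  + (∫ θ in x..b, N.k20 x y θ *ᵥ u θ y)
  + (∫ ν in c..y, N.k01 x y ν *ᵥ u x ν)
  + (∫ ν in y..d, N.k02 x y ν *ᵥ u x ν)
  + (∫ θ in a..x, ∫ ν in c..y, N.k11 x y θ ν *ᵥ u θ ν)
  + (∫ θ in x..b, ∫ ν in c..y, N.k21 x y θ ν *ᵥ u θ ν)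
  + (∫ θ in a..x, ∫ ν in y..d, N.k12 x y θ ν *ᵥ u θ ν)
  + (∫ θ in x..b, ∫ ν in y..d, N.k22 x y θ ν *ᵥ u θ ν)

/-- A family of 011-PI kernels of size `(p0,p1) × (r0,r1)`. -/
structure PI011K (p0 p1 r0 r1 : ℕ) where
  b00 : Matrix (Fin p0) (Fin r0) ℝ
  b01 : ℝ → Matrix (Fin p0) (Fin r1) ℝ
  b02 : ℝ → Matrix (Fin p0) (Fin r1) ℝ
  b10 : ℝ → Matrix (Fin p1) (Fin r0) ℝ
  b20 : ℝ → Matrix (Fin p1) (Fin r0) ℝ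
  b12 : ℝ → ℝ → Matrix (Fin p1) (Fin r1) ℝ
  b21 : ℝ → ℝ → Matrix (Fin p1) (Fin r1) ℝ
  b11 : PI1DK p1 r1
  b22 : PI1DK p1 r1

/-- Continuity of a family of 011-PI kernels. -/
def PI011K.IsCont {p0 p1 r0 r1 : ℕ} (a b c d : ℝ) (B : PI011K p0 p1 r0 r1) : Prop :=
  ContinuousOn B.b01 (Icc a b) ∧ ContinuousOn B.b02 (Icc c d) ∧
  ContinuousOn B.b10 (Icc a b) ∧ ContinuousOn B.b20 (Icc c d) ∧
  ContinuousOn (fun q : ℝ × ℝ => B.b12 q.1 q.2) (Icc a b ×ˢ Icc c d) ∧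
  ContinuousOn (fun q : ℝ × ℝ => B.b21 q.1 q.2) (Icc c d ×ˢ Icc a b) ∧
  B.b11.IsCont a b ∧ B.b22.IsCont c d

/-- The 011-PI operator associated with the kernels `B`. -/
def PI011 {p0 p1 r0 r1 : ℕ} (a b c d : ℝ) (B : PI011K p0 p1 r0 r1)
    (v : Fin r0 → ℝ) (u1 u2 : ℝ → Fin r1 → ℝ) :
    (Fin p0 → ℝ) × (ℝ → Fin p1 → ℝ) × (ℝ → Fin p1 → ℝ) :=
  ( B.b00 *ᵥ v + (∫ θ in a..b, B.b01 θ *ᵥ u1 θ) + (∫ ν in c..d, B.b02 ν *ᵥ u2 ν),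
    fun x => B.b10 x *ᵥ v + PI1D a b B.b11 u1 x + (∫ ν in c..d, B.b12 x ν *ᵥ u2 ν),
    fun y => B.b20 y *ᵥ v + (∫ θ in a..b, B.b21 y θ *ᵥ u1 θ) + PI1D c d B.b22 u2 y )

/-- A family of (2D→011)-PI kernels of size `(p0,p1) × r`. -/
structure PI2Dto011K (p0 p1 r : ℕ) where
  d0 : ℝ → ℝ → Matrix (Fin p0) (Fin r) ℝ
  d10 : ℝ → ℝ → Matrix (Fin p1) (Fin r) ℝ
  d11 : ℝ → ℝ → ℝ → Matrix (Fin p1) (Fin r) ℝ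
  d12 : ℝ → ℝ → ℝ → Matrix (Fin p1) (Fin r) ℝ
  d20 : ℝ → ℝ → Matrix (Fin p1) (Fin r) ℝ
  d21 : ℝ → ℝ → ℝ → Matrix (Fin p1) (Fin r) ℝ
  d22 : ℝ → ℝ → ℝ → Matrix (Fin p1) (Fin r) ℝ

/-- Continuity of a family of (2D→011)-PI kernels. -/
def PI2Dto011K.IsCont {p0 p1 r : ℕ} (a b c d : ℝ) (D : PI2Dto011K p0 p1 r) : Prop :=
  ContinuousOn (fun q : ℝ × ℝ => D.d0 q.1 q.2) (Icc a b ×ˢ Icc c d) ∧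
  ContinuousOn (fun q : ℝ × ℝ => D.d10 q.1 q.2) (Icc a b ×ˢ Icc c d) ∧
  ContinuousOn (fun q : ℝ × ℝ × ℝ => D.d11 q.1 q.2.1 q.2.2)
    (Icc a b ×ˢ Icc c d ×ˢ Icc a b) ∧
  ContinuousOn (fun q : ℝ × ℝ × ℝ => D.d12 q.1 q.2.1 q.2.2)
    (Icc a b ×ˢ Icc c d ×ˢ Icc a b) ∧
  ContinuousOn (fun q : ℝ × ℝ => D.d20 q.1 q.2) (Icc a b ×ˢ Icc c d) ∧
  ContinuousOn (fun q : ℝ × ℝ × ℝ => D.d21 q.1 q.2.1 q.2.2)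
    (Icc a b ×ˢ Icc c d ×ˢ Icc c d) ∧
  ContinuousOn (fun q : ℝ × ℝ × ℝ => D.d22 q.1 q.2.1 q.2.2)
    (Icc a b ×ˢ Icc c d ×ˢ Icc c d)

/-- The (2D→011)-PI operator associated with the kernels `D`. -/
def PI2Dto011 {p0 p1 r : ℕ} (a b c d : ℝ) (D : PI2Dto011K p0 p1 r)
    (u : ℝ → ℝ → Fin r → ℝ) :
    (Fin p0 → ℝ) × (ℝ → Fin p1 → ℝ) × (ℝ → Fin p1 → ℝ) :=
  ( ∫ θ in a..b, ∫ ν in c..d, D.d0 θ ν *ᵥ u θ ν,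
    fun x => ∫ y in c..d,
      (D.d10 x y *ᵥ u x y + (∫ θ in a..x, D.d11 x y θ *ᵥ u θ y)
        + (∫ θ in x..b, D.d12 x y θ *ᵥ u θ y)),
    fun y => ∫ x in a..b,
      (D.d20 x y *ᵥ u x y + (∫ ν in c..y, D.d21 x y ν *ᵥ u x ν)
        + (∫ ν in y..d, D.d22 x y ν *ᵥ u x ν)) )

/-- A family of (011→2D)-PI kernels of size `p × (r0,r1)`. -/
structure PI011to2DK (p r0 r1 : ℕ) where
  e0 : ℝ → ℝ → Matrix (Fin p) (Fin r0) ℝ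
  e10 : ℝ → ℝ → Matrix (Fin p) (Fin r1) ℝ
  e11 : ℝ → ℝ → ℝ → Matrix (Fin p) (Fin r1) ℝ
  e12 : ℝ → ℝ → ℝ → Matrix (Fin p) (Fin r1) ℝ
  e20 : ℝ → ℝ → Matrix (Fin p) (Fin r1) ℝ
  e21 : ℝ → ℝ → ℝ → Matrix (Fin p) (Fin r1) ℝ
  e22 : ℝ → ℝ → ℝ → Matrix (Fin p) (Fin r1) ℝ

/-- Continuity of a family of (011→2D)-PI kernels. -/
def PI011to2DK.IsCont {p r0 r1 : ℕ} (a b c d : ℝ) (E : PI011to2DK p r0 r1) : Prop :=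
  ContinuousOn (fun q : ℝ × ℝ => E.e0 q.1 q.2) (Icc a b ×ˢ Icc c d) ∧
  ContinuousOn (fun q : ℝ × ℝ => E.e10 q.1 q.2) (Icc a b ×ˢ Icc c d) ∧
  ContinuousOn (fun q : ℝ × ℝ × ℝ => E.e11 q.1 q.2.1 q.2.2)
    (Icc a b ×ˢ Icc c d ×ˢ Icc a b) ∧
  ContinuousOn (fun q : ℝ × ℝ × ℝ => E.e12 q.1 q.2.1 q.2.2)
    (Icc a b ×ˢ Icc c d ×ˢ Icc a b) ∧
  ContinuousOn (fun q : ℝ × ℝ => E.e20 q.1 q.2) (Icc a b ×ˢ Icc c d) ∧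
  ContinuousOn (fun q : ℝ × ℝ × ℝ => E.e21 q.1 q.2.1 q.2.2)
    (Icc a b ×ˢ Icc c d ×ˢ Icc c d) ∧
  ContinuousOn (fun q : ℝ × ℝ × ℝ => E.e22 q.1 q.2.1 q.2.2)
    (Icc a b ×ˢ Icc c d ×ˢ Icc c d)

/-- The (011→2D)-PI operator associated with the kernels `E`. -/
def PI011to2D {p r0 r1 : ℕ} (a b c d : ℝ) (E : PI011to2DK p r0 r1)
    (v : Fin r0 → ℝ) (u1 u2 : ℝ → Fin r1 → ℝ) (x y : ℝ) : Fin p → ℝ :=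
  E.e0 x y *ᵥ v + E.e10 x y *ᵥ u1 x
  + (∫ θ in a..x, E.e11 x y θ *ᵥ u1 θ) + (∫ θ in x..b, E.e12 x y θ *ᵥ u1 θ)
  + E.e20 x y *ᵥ u2 y
  + (∫ ν in c..y, E.e21 x y ν *ᵥ u2 ν) + (∫ ν in y..d, E.e22 x y ν *ᵥ u2 ν)

section Auxiliary

attribute [local instance] Matrix.normedAddCommGroup Matrix.normedSpace

@[fun_prop]
theorem Continuous.parametric_intervalIntegral {P E : Type*} [TopologicalSpace P]
    [FirstCountableTopology P] [LocallyCompactSpace P] [NormedAddCommGroup E] [NormedSpace ℝ E]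
    {f : P → ℝ → E} {s t : P → ℝ} (hf : Continuous fun q : P × ℝ => f q.1 q.2)
    (hs : Continuous s) (ht : Continuous t) :
    Continuous fun p => ∫ η in s p..t p, f p η := by
  have h : ∀ p, ∫ η in s p..t p, f p η
      = (∫ η in (0 : ℝ)..t p, f p η) - ∫ η in (0 : ℝ)..s p, f p η := by
    intro p
    have hc : Continuous (f p) := by fun_prop
    rw [intervalIntegral.integral_interval_sub_left] <;> exact hc.intervalIntegrable _ _
  simp only [h]
  exact (intervalIntegral.continuous_parametric_intervalIntegral_of_continuous hf ht).sub
    (intervalIntegral.continuous_parametric_intervalIntegral_of_continuous hf hs)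

theorem Matrix.mulVec_intervalIntegral {n p : ℕ} (A : Matrix (Fin n) (Fin p) ℝ)
    {f : ℝ → Fin p → ℝ} (hf : Continuous f) (s t : ℝ) :
    A *ᵥ (∫ η in s..t, f η) = ∫ η in s..t, A *ᵥ f η :=
  ((Matrix.mulVecLin A).toContinuousLinearMap.intervalIntegral_comp_comm
    (hf.intervalIntegrable s t)).symm

theorem Matrix.intervalIntegral_mulVec {n p : ℕ} {A : ℝ → Matrix (Fin n) (Fin p) ℝ}
    (hA : Continuous A) (v : Fin p → ℝ) (s t : ℝ) :
    (∫ η in s..t, A η) *ᵥ v = ∫ η in s..t, A η *ᵥ v :=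
  (((Matrix.mulVecBilin ℝ ℝ).flip v).toContinuousLinearMap.intervalIntegral_comp_comm
    (hA.intervalIntegrable s t)).symm

section Fubini

variable {E : Type*} [NormedAddCommGroup E] [NormedSpace ℝ E]

theorem Continuous.intervalIntegral_swap {f : ℝ → ℝ → E}
    (hf : Continuous fun q : ℝ × ℝ => f q.1 q.2) (s t s' t' : ℝ) :
    ∫ y in s..t, ∫ ν in s'..t', f y ν = ∫ ν in s'..t', ∫ y in s..t, f y ν := by
  apply intervalIntegral_intervalIntegral_swap
  refine (ContinuousOn.integrableOn_compact (isCompact_uIcc.prod isCompact_uIcc)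
    hf.continuousOn).mono_set (prod_mono uIoc_subset_uIcc uIoc_subset_uIcc)

/-- Dirichlet's formula: interchanging the order of integration over a triangle. -/
theorem Continuous.intervalIntegral_swap_triangle {f : ℝ → ℝ → E}
    (hf : Continuous fun q : ℝ × ℝ => f q.1 q.2) {s t : ℝ} (hst : s ≤ t) :
    ∫ y in s..t, ∫ ν in s..y, f y ν = ∫ ν in s..t, ∫ y in ν..t, f y ν := by
  have hT : MeasurableSet {q : ℝ × ℝ | q.2 ≤ q.1} := measurableSet_le measurable_snd measurable_fst
  have hint : Integrable (Function.uncurry fun y ν => {q : ℝ × ℝ | q.2 ≤ q.1}.indicator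
      (fun q : ℝ × ℝ => f q.1 q.2) (y, ν))
      ((volume.restrict (Ioc s t)).prod (volume.restrict (Ioc s t))) := by
    rw [Measure.prod_restrict]
    refine Integrable.indicator (IntegrableOn.mono_set (ContinuousOn.integrableOn_compact
      (isCompact_Icc.prod isCompact_Icc) hf.continuousOn)
      (prod_mono Ioc_subset_Icc_self Ioc_subset_Icc_self)) hT
  have hswap := integral_integral_swap hint
  rw [intervalIntegral.integral_of_le hst, intervalIntegral.integral_of_le hst]
  convert hswap using 1
  · refine setIntegral_congr_fun measurableSet_Ioc fun y hy => ?_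
    rw [intervalIntegral.integral_of_le hy.1.le,
      show Ioc s y = Ioc s t ∩ Iic y by
        ext z; simp only [mem_Ioc, mem_inter_iff, mem_Iic]; grind,
      ← setIntegral_indicator measurableSet_Iic]
    rfl
  · refine setIntegral_congr_fun measurableSet_Ioc fun ν hν => ?_
    rw [intervalIntegral.integral_of_le hν.2, ← integral_Icc_eq_integral_Ioc,
      show Icc ν t = Ioc s t ∩ Ici ν by
        ext z; simp only [mem_Ioc, mem_inter_iff, mem_Ici, mem_Icc]; grind,
      ← setIntegral_indicator measurableSet_Ici]
    rfl

theorem Continuous.intervalIntegral_swap_triangle' {f : ℝ → ℝ → E}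
    (hf : Continuous fun q : ℝ × ℝ => f q.1 q.2) {s t : ℝ} (hst : s ≤ t) :
    ∫ y in s..t, ∫ ν in y..t, f y ν = ∫ ν in s..t, ∫ y in s..ν, f y ν :=
  (Continuous.intervalIntegral_swap_triangle (f := fun y ν => f ν y) (by fun_prop) hst).symm

theorem Continuous.intervalIntegral_add {f g : ℝ → E} (hf : Continuous f) (hg : Continuous g)
    (s t : ℝ) : ∫ η in s..t, (f η + g η) = (∫ η in s..t, f η) + ∫ η in s..t, g η :=
  intervalIntegral.integral_add (hf.intervalIntegrable s t) (hg.intervalIntegrable s t)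

theorem Continuous.intervalIntegral_split {f : ℝ → E} (hf : Continuous f) (s m t : ℝ) :
    ∫ η in s..t, f η = (∫ η in s..m, f η) + ∫ η in m..t, f η :=
  (intervalIntegral.integral_add_adjacent_intervals (hf.intervalIntegrable s m)
    (hf.intervalIntegrable m t)).symm

/-- Interchanging the order of integration in a 1D-PI operator composed with the lower and upper
integral parts of another one. -/
theorem intervalIntegral_PI_swap {f₀ g₀ : ℝ → E} {f₁ f₂ g₁ g₂ : ℝ → ℝ → E}
    (hf₀ : Continuous f₀) (hg₀ : Continuous g₀)
    (hf₁ : Continuous fun q : ℝ × ℝ => f₁ q.1 q.2) (hf₂ : Continuous fun q : ℝ × ℝ => f₂ q.1 q.2)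
    (hg₁ : Continuous fun q : ℝ × ℝ => g₁ q.1 q.2) (hg₂ : Continuous fun q : ℝ × ℝ => g₂ q.1 q.2)
    {a b x : ℝ} (hx : x ∈ Icc a b) :
    (∫ θ in a..x, (f₀ θ + (∫ η in a..θ, f₁ θ η) + ∫ η in θ..b, f₂ θ η))
      + (∫ θ in x..b, (g₀ θ + (∫ η in a..θ, g₁ θ η) + ∫ η in θ..b, g₂ θ η))
    = (∫ η in a..x, (f₀ η + (∫ θ in η..x, f₁ θ η) + (∫ θ in a..η, f₂ θ η) + ∫ θ in x..b, g₁ θ η))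
      + (∫ η in x..b, (g₀ η + (∫ θ in a..x, f₂ θ η) + (∫ θ in η..b, g₁ θ η)
        + ∫ θ in x..η, g₂ θ η)) := by
  have e1 : ∀ θ, ∫ η in θ..b, f₂ θ η = (∫ η in θ..x, f₂ θ η) + ∫ η in x..b, f₂ θ η :=
    fun θ => Continuous.intervalIntegral_split (by fun_prop) _ _ _
  have e2 : ∀ θ, ∫ η in a..θ, g₁ θ η = (∫ η in a..x, g₁ θ η) + ∫ η in x..θ, g₁ θ η :=
    fun θ => Continuous.intervalIntegral_split (by fun_prop) _ _ _
  simp only [e1, e2]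
  simp (disch := fun_prop) only [Continuous.intervalIntegral_add]
  rw [Continuous.intervalIntegral_swap_triangle hf₁ hx.1,
    Continuous.intervalIntegral_swap_triangle' hf₂ hx.1,
    Continuous.intervalIntegral_swap_triangle hg₁ hx.2,
    Continuous.intervalIntegral_swap_triangle' hg₂ hx.2,
    Continuous.intervalIntegral_swap hf₂, Continuous.intervalIntegral_swap hg₁]
  abel

end Fubini

/-- Continuity of a family of 2D-PI kernels on the whole space. -/
def PI2DK.IsContinuous {p r : ℕ} (N : PI2DK p r) : Prop :=
  (Continuous fun q : ℝ × ℝ => N.k00 q.1 q.2) ∧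
  (Continuous fun q : ℝ × ℝ × ℝ => N.k10 q.1 q.2.1 q.2.2) ∧
  (Continuous fun q : ℝ × ℝ × ℝ => N.k20 q.1 q.2.1 q.2.2) ∧
  (Continuous fun q : ℝ × ℝ × ℝ => N.k01 q.1 q.2.1 q.2.2) ∧
  (Continuous fun q : ℝ × ℝ × ℝ => N.k02 q.1 q.2.1 q.2.2) ∧
  (Continuous fun q : ℝ × ℝ × ℝ × ℝ => N.k11 q.1 q.2.1 q.2.2.1 q.2.2.2) ∧
  (Continuous fun q : ℝ × ℝ × ℝ × ℝ => N.k21 q.1 q.2.1 q.2.2.1 q.2.2.2) ∧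
  (Continuous fun q : ℝ × ℝ × ℝ × ℝ => N.k12 q.1 q.2.1 q.2.2.1 q.2.2.2) ∧
  (Continuous fun q : ℝ × ℝ × ℝ × ℝ => N.k22 q.1 q.2.1 q.2.2.1 q.2.2.2)

theorem PI2DK.IsContinuous.continuous_PI2D {p m : ℕ} {a b c d : ℝ} {N : PI2DK p m}
    (hN : N.IsContinuous) {u : ℝ → ℝ → Fin m → ℝ} (hu : Continuous fun q : ℝ × ℝ => u q.1 q.2) :
    Continuous fun q : ℝ × ℝ => PI2D a b c d N u q.1 q.2 := by
  obtain ⟨h00, h10, h20, h01, h02, h11, h21, h12, h22⟩ := hN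
  obtain ⟨N00, N10, N20, N01, N02, N11, N21, N12, N22⟩ := N
  simp only at h00 h10 h20 h01 h02 h11 h21 h12 h22
  simp only [PI2D]
  fun_prop

theorem integral_intervalIntegral_mulVec {n m : ℕ} {M : ℝ → ℝ → Matrix (Fin n) (Fin m) ℝ}
    {w : ℝ → Fin m → ℝ} (hM : Continuous fun q : ℝ × ℝ => M q.1 q.2) (hw : Continuous w)
    (c d s t : ℝ) :
    ∫ y in c..d, (∫ θ in s..t, M θ y) *ᵥ w y = ∫ θ in s..t, ∫ y in c..d, M θ y *ᵥ w y := by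
  rw [Continuous.intervalIntegral_swap (by fun_prop) s t c d]
  congr 1
  ext1 y
  exact intervalIntegral_mulVec (by fun_prop) _ _ _

theorem integral_PI1D_eq {n m : ℕ} {a b c d x : ℝ} {M0 : ℝ → Matrix (Fin n) (Fin m) ℝ}
    {M1 M2 : ℝ → ℝ → Matrix (Fin n) (Fin m) ℝ} {u : ℝ → ℝ → Fin m → ℝ} (h0 : Continuous M0)
    (h1 : Continuous fun q : ℝ × ℝ => M1 q.1 q.2) (h2 : Continuous fun q : ℝ × ℝ => M2 q.1 q.2)
    (hu : Continuous fun q : ℝ × ℝ => u q.1 q.2) :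
    ∫ y in c..d, (M0 y *ᵥ u x y + (∫ θ in a..x, M1 y θ *ᵥ u θ y)
        + ∫ θ in x..b, M2 y θ *ᵥ u θ y)
      = (∫ y in c..d, M0 y *ᵥ u x y) + (∫ θ in a..x, ∫ y in c..d, M1 y θ *ᵥ u θ y)
        + ∫ θ in x..b, ∫ y in c..d, M2 y θ *ᵥ u θ y := by
  rw [Continuous.intervalIntegral_swap (by fun_prop) a x c d,
    Continuous.intervalIntegral_swap (by fun_prop) x b c d,
    Continuous.intervalIntegral_add (by fun_prop) (by fun_prop),
    Continuous.intervalIntegral_add (by fun_prop) (by fun_prop)]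

section Kernels

variable {P : Type*} [TopologicalSpace P] [FirstCountableTopology P] [LocallyCompactSpace P]

/-- An integral functional composed with a 1D-PI operator is an integral functional. -/
theorem exists_kernel_functional_comp_PI1D {n p m : ℕ} {c d : ℝ} (hcd : c ≤ d)
    {G : P → ℝ → Matrix (Fin n) (Fin p) ℝ} {N0 : P → ℝ → Matrix (Fin p) (Fin m) ℝ}
    {N1 N2 : P → ℝ → ℝ → Matrix (Fin p) (Fin m) ℝ}
    (hG : Continuous fun q : P × ℝ => G q.1 q.2) (h0 : Continuous fun q : P × ℝ => N0 q.1 q.2)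
    (h1 : Continuous fun q : P × ℝ × ℝ => N1 q.1 q.2.1 q.2.2)
    (h2 : Continuous fun q : P × ℝ × ℝ => N2 q.1 q.2.1 q.2.2) :
    ∃ K : P → ℝ → Matrix (Fin n) (Fin m) ℝ, (Continuous fun q : P × ℝ => K q.1 q.2) ∧
      ∀ q (w : ℝ → Fin m → ℝ), Continuous w →
        ∫ y in c..d, G q y *ᵥ (N0 q y *ᵥ w y + (∫ ν in c..y, N1 q y ν *ᵥ w ν)
          + ∫ ν in y..d, N2 q y ν *ᵥ w ν) = ∫ y in c..d, K q y *ᵥ w y := by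
  refine ⟨fun q ν => G q ν * N0 q ν + (∫ y in ν..d, G q y * N1 q y ν)
    + ∫ y in c..ν, G q y * N2 q y ν, by fun_prop, fun q w hw => ?_⟩
  have e1 : ∀ y, G q y *ᵥ (N0 q y *ᵥ w y + (∫ ν in c..y, N1 q y ν *ᵥ w ν)
      + ∫ ν in y..d, N2 q y ν *ᵥ w ν) = (G q y * N0 q y) *ᵥ w y
        + (∫ ν in c..y, (G q y * N1 q y ν) *ᵥ w ν) + ∫ ν in y..d, (G q y * N2 q y ν) *ᵥ w ν := by
    intro y
    rw [mulVec_add, mulVec_add, mulVec_intervalIntegral _ (by fun_prop),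
      mulVec_intervalIntegral _ (by fun_prop)]
    simp only [mulVec_mulVec]
  have e2 : ∀ ν, (G q ν * N0 q ν + (∫ y in ν..d, G q y * N1 q y ν)
      + ∫ y in c..ν, G q y * N2 q y ν) *ᵥ w ν = (G q ν * N0 q ν) *ᵥ w ν
        + (∫ y in ν..d, (G q y * N1 q y ν) *ᵥ w ν) + ∫ y in c..ν, (G q y * N2 q y ν) *ᵥ w ν := by
    intro ν
    rw [add_mulVec, add_mulVec, intervalIntegral_mulVec (by fun_prop),
      intervalIntegral_mulVec (by fun_prop)]
  simp only [e1, e2]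
  rw [Continuous.intervalIntegral_add (by fun_prop) (by fun_prop),
    Continuous.intervalIntegral_add (by fun_prop) (by fun_prop),
    Continuous.intervalIntegral_add (by fun_prop) (by fun_prop),
    Continuous.intervalIntegral_add (by fun_prop) (by fun_prop),
    Continuous.intervalIntegral_swap_triangle
      (f := fun y ν => (G q y * N1 q y ν) *ᵥ w ν) (by fun_prop) hcd,
    Continuous.intervalIntegral_swap_triangle'
      (f := fun y ν => (G q y * N2 q y ν) *ᵥ w ν) (by fun_prop) hcd]

/-- An integral functional in `y` composed with a 2D-PI operator. -/
theorem exists_kernel_functional_comp_PI2D {n p m : ℕ} {a b c d : ℝ} (hcd : c ≤ d)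
    {G : P → ℝ → Matrix (Fin n) (Fin p) ℝ} {ξ : P → ℝ} {N : PI2DK p m}
    (hG : Continuous fun q : P × ℝ => G q.1 q.2) (hξ : Continuous ξ) (hN : N.IsContinuous) :
    ∃ (K0 : P → ℝ → Matrix (Fin n) (Fin m) ℝ) (K1 K2 : P → ℝ → ℝ → Matrix (Fin n) (Fin m) ℝ),
      (Continuous fun q : P × ℝ => K0 q.1 q.2) ∧
      (Continuous fun q : P × ℝ × ℝ => K1 q.1 q.2.1 q.2.2) ∧
      (Continuous fun q : P × ℝ × ℝ => K2 q.1 q.2.1 q.2.2) ∧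
      ∀ q (u : ℝ → ℝ → Fin m → ℝ), (Continuous fun z : ℝ × ℝ => u z.1 z.2) →
        ∫ y in c..d, G q y *ᵥ PI2D a b c d N u (ξ q) y
          = (∫ y in c..d, K0 q y *ᵥ u (ξ q) y)
            + (∫ θ in a..ξ q, ∫ y in c..d, K1 q θ y *ᵥ u θ y)
            + ∫ θ in ξ q..b, ∫ y in c..d, K2 q θ y *ᵥ u θ y := by
  obtain ⟨N00, N10, N20, N01, N02, N11, N21, N12, N22⟩ := N
  obtain ⟨h00, h10, h20, h01, h02, h11, h21, h12, h22⟩ := hN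
  simp only at h00 h10 h20 h01 h02 h11 h21 h12 h22
  obtain ⟨K0, hK0, e0⟩ := exists_kernel_functional_comp_PI1D (P := P) hcd hG
    (N0 := fun q y => N00 (ξ q) y) (N1 := fun q y ν => N01 (ξ q) y ν)
    (N2 := fun q y ν => N02 (ξ q) y ν) (by fun_prop) (by fun_prop) (by fun_prop)
  obtain ⟨K1, hK1, e1⟩ := exists_kernel_functional_comp_PI1D (P := P × ℝ) hcd
    (G := fun q y => G q.1 y)
    (N0 := fun q y => N10 (ξ q.1) y q.2) (N1 := fun q y ν => N11 (ξ q.1) y q.2 ν)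
    (N2 := fun q y ν => N12 (ξ q.1) y q.2 ν)
    (by fun_prop) (by fun_prop) (by fun_prop) (by fun_prop)
  obtain ⟨K2, hK2, e2⟩ := exists_kernel_functional_comp_PI1D (P := P × ℝ) hcd
    (G := fun q y => G q.1 y)
    (N0 := fun q y => N20 (ξ q.1) y q.2) (N1 := fun q y ν => N21 (ξ q.1) y q.2 ν)
    (N2 := fun q y ν => N22 (ξ q.1) y q.2 ν)
    (by fun_prop) (by fun_prop) (by fun_prop) (by fun_prop)
  refine ⟨K0, fun q θ y => K1 (q, θ) y, fun q θ y => K2 (q, θ) y, hK0, by fun_prop, by fun_prop,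
    fun q u hu => ?_⟩
  have e1' := fun θ => e1 (q, θ) (u θ) (by fun_prop)
  have e2' := fun θ => e2 (q, θ) (u θ) (by fun_prop)
  rw [← e0 q (u (ξ q)) (by fun_prop)]
  simp only [← e1', ← e2']
  rw [Continuous.intervalIntegral_swap (by fun_prop) a (ξ q) c d,
    Continuous.intervalIntegral_swap (by fun_prop) (ξ q) b c d,
    ← Continuous.intervalIntegral_add (by fun_prop) (by fun_prop),
    ← Continuous.intervalIntegral_add (by fun_prop) (by fun_prop)]
  congr 1
  ext1 y
  rw [← mulVec_intervalIntegral _ (by fun_prop), ← mulVec_intervalIntegral _ (by fun_prop),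
    ← mulVec_add, ← mulVec_add]
  congr 1
  simp (disch := fun_prop) only [Continuous.intervalIntegral_add, PI2D]
  abel

end Kernels

/-- The second component of a (2D→011)-PI operator composed with a 2D-PI operator. -/
theorem exists_kernel_comp_PI2D {n p m : ℕ} {a b c d : ℝ} (hcd : c ≤ d)
    {D0 : ℝ → ℝ → Matrix (Fin n) (Fin p) ℝ} {D1 D2 : ℝ → ℝ → ℝ → Matrix (Fin n) (Fin p) ℝ}
    {N : PI2DK p m}
    (h0 : Continuous fun q : ℝ × ℝ => D0 q.1 q.2)
    (h1 : Continuous fun q : ℝ × ℝ × ℝ => D1 q.1 q.2.1 q.2.2)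
    (h2 : Continuous fun q : ℝ × ℝ × ℝ => D2 q.1 q.2.1 q.2.2) (hN : N.IsContinuous) :
    ∃ (S0 : ℝ → ℝ → Matrix (Fin n) (Fin m) ℝ) (S1 S2 : ℝ → ℝ → ℝ → Matrix (Fin n) (Fin m) ℝ),
      (Continuous fun q : ℝ × ℝ => S0 q.1 q.2) ∧
      (Continuous fun q : ℝ × ℝ × ℝ => S1 q.1 q.2.1 q.2.2) ∧
      (Continuous fun q : ℝ × ℝ × ℝ => S2 q.1 q.2.1 q.2.2) ∧
      ∀ u : ℝ → ℝ → Fin m → ℝ, (Continuous fun z : ℝ × ℝ => u z.1 z.2) → ∀ x ∈ Icc a b,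
        ∫ y in c..d, (D0 x y *ᵥ PI2D a b c d N u x y
            + (∫ θ in a..x, D1 x y θ *ᵥ PI2D a b c d N u θ y)
            + ∫ θ in x..b, D2 x y θ *ᵥ PI2D a b c d N u θ y)
          = ∫ y in c..d, (S0 x y *ᵥ u x y + (∫ θ in a..x, S1 x y θ *ᵥ u θ y)
            + ∫ θ in x..b, S2 x y θ *ᵥ u θ y) := by
  obtain ⟨A0, A1, A2, hA0, hA1, hA2, eA⟩ := exists_kernel_functional_comp_PI2D (P := ℝ)
    (a := a) (b := b) hcd h0 continuous_id hN
  obtain ⟨B0, B1, B2, hB0, hB1, hB2, eB⟩ := exists_kernel_functional_comp_PI2D (P := ℝ × ℝ)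
    (a := a) (b := b) hcd (G := fun q y => D1 q.1 y q.2) (by fun_prop) continuous_snd hN
  obtain ⟨C0, C1, C2, hC0, hC1, hC2, eC⟩ := exists_kernel_functional_comp_PI2D (P := ℝ × ℝ)
    (a := a) (b := b) hcd (G := fun q y => D2 q.1 y q.2) (by fun_prop) continuous_snd hN
  refine ⟨A0, fun x y η => A1 x η y + (B0 (x, η) y + (∫ θ in η..x, B1 (x, θ) η y)
      + (∫ θ in a..η, B2 (x, θ) η y) + ∫ θ in x..b, C1 (x, θ) η y),
    fun x y η => A2 x η y + (C0 (x, η) y + (∫ θ in a..x, B2 (x, θ) η y)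
      + (∫ θ in η..b, C1 (x, θ) η y) + ∫ θ in x..η, C2 (x, θ) η y),
    hA0, by fun_prop, by fun_prop, fun u hu x hx => ?_⟩
  have hv := hN.continuous_PI2D (a := a) (b := b) (c := c) (d := d) hu
  rw [integral_PI1D_eq (by fun_prop) (by fun_prop) (by fun_prop) hv,
    integral_PI1D_eq (by fun_prop) (by fun_prop) (by fun_prop) hu]
  have eA' := eA x u hu
  have eB' := fun θ => eB (x, θ) u hu
  have eC' := fun θ => eC (x, θ) u hu
  simp only [id] at eA' eB' eC'
  simp only [eA', eB', eC']
  rw [add_assoc, intervalIntegral_PI_swap (by fun_prop) (by fun_prop) (by fun_prop)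
      (by fun_prop) (by fun_prop) (by fun_prop) hx]
  have e1 : ∀ η, ∫ y in c..d, (A1 x η y + (B0 (x, η) y + (∫ θ in η..x, B1 (x, θ) η y)
        + (∫ θ in a..η, B2 (x, θ) η y) + ∫ θ in x..b, C1 (x, θ) η y)) *ᵥ u η y
      = (∫ y in c..d, A1 x η y *ᵥ u η y) + ((∫ y in c..d, B0 (x, η) y *ᵥ u η y)
        + (∫ θ in η..x, ∫ y in c..d, B1 (x, θ) η y *ᵥ u η y)
        + (∫ θ in a..η, ∫ y in c..d, B2 (x, θ) η y *ᵥ u η y)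
        + ∫ θ in x..b, ∫ y in c..d, C1 (x, θ) η y *ᵥ u η y) := by
    intro η
    simp only [add_mulVec]
    rw [Continuous.intervalIntegral_add (by fun_prop) (by fun_prop),
      Continuous.intervalIntegral_add (by fun_prop) (by fun_prop),
      Continuous.intervalIntegral_add (by fun_prop) (by fun_prop),
      Continuous.intervalIntegral_add (by fun_prop) (by fun_prop),
      integral_intervalIntegral_mulVec (by fun_prop) (by fun_prop),
      integral_intervalIntegral_mulVec (by fun_prop) (by fun_prop),
      integral_intervalIntegral_mulVec (by fun_prop) (by fun_prop)]
  have e2 : ∀ η, ∫ y in c..d, (A2 x η y + (C0 (x, η) y + (∫ θ in a..x, B2 (x, θ) η y)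
        + (∫ θ in η..b, C1 (x, θ) η y) + ∫ θ in x..η, C2 (x, θ) η y)) *ᵥ u η y
      = (∫ y in c..d, A2 x η y *ᵥ u η y) + ((∫ y in c..d, C0 (x, η) y *ᵥ u η y)
        + (∫ θ in a..x, ∫ y in c..d, B2 (x, θ) η y *ᵥ u η y)
        + (∫ θ in η..b, ∫ y in c..d, C1 (x, θ) η y *ᵥ u η y)
        + ∫ θ in x..η, ∫ y in c..d, C2 (x, θ) η y *ᵥ u η y) := by
    intro η
    simp only [add_mulVec]
    rw [Continuous.intervalIntegral_add (by fun_prop) (by fun_prop),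
      Continuous.intervalIntegral_add (by fun_prop) (by fun_prop),
      Continuous.intervalIntegral_add (by fun_prop) (by fun_prop),
      Continuous.intervalIntegral_add (by fun_prop) (by fun_prop),
      integral_intervalIntegral_mulVec (by fun_prop) (by fun_prop),
      integral_intervalIntegral_mulVec (by fun_prop) (by fun_prop),
      integral_intervalIntegral_mulVec (by fun_prop) (by fun_prop)]
  simp only [e1, e2]
  rw [Continuous.intervalIntegral_add (f := fun η => ∫ y in c..d, A1 x η y *ᵥ u η y)
      (by fun_prop) (by fun_prop),
    Continuous.intervalIntegral_add (f := fun η => ∫ y in c..d, A2 x η y *ᵥ u η y)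
      (by fun_prop) (by fun_prop)]
  abel

/-- Continuity of a family of (2D→011)-PI kernels on the whole space. -/
def PI2Dto011K.IsContinuous {p0 p1 r : ℕ} (D : PI2Dto011K p0 p1 r) : Prop :=
  (Continuous fun q : ℝ × ℝ => D.d0 q.1 q.2) ∧
  (Continuous fun q : ℝ × ℝ => D.d10 q.1 q.2) ∧
  (Continuous fun q : ℝ × ℝ × ℝ => D.d11 q.1 q.2.1 q.2.2) ∧
  (Continuous fun q : ℝ × ℝ × ℝ => D.d12 q.1 q.2.1 q.2.2) ∧
  (Continuous fun q : ℝ × ℝ => D.d20 q.1 q.2) ∧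
  (Continuous fun q : ℝ × ℝ × ℝ => D.d21 q.1 q.2.1 q.2.2) ∧
  (Continuous fun q : ℝ × ℝ × ℝ => D.d22 q.1 q.2.1 q.2.2)

theorem PI2Dto011K.IsContinuous.isCont {p0 p1 r : ℕ} {D : PI2Dto011K p0 p1 r}
    (hD : D.IsContinuous) (a b c d : ℝ) : D.IsCont a b c d := by
  obtain ⟨h0, h10, h11, h12, h20, h21, h22⟩ := hD
  exact ⟨h0.continuousOn, h10.continuousOn, h11.continuousOn, h12.continuousOn,
    h20.continuousOn, h21.continuousOn, h22.continuousOn⟩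

section Swap

/-- The 2D-PI kernels obtained by exchanging the roles of the two variables. -/
def PI2DK.swap {p r : ℕ} (N : PI2DK p r) : PI2DK p r where
  k00 y x := N.k00 x y
  k10 y x ν := N.k01 x y ν
  k20 y x ν := N.k02 x y ν
  k01 y x θ := N.k10 x y θ
  k02 y x θ := N.k20 x y θ
  k11 y x ν θ := N.k11 x y θ ν
  k21 y x ν θ := N.k12 x y θ ν
  k12 y x ν θ := N.k21 x y θ ν
  k22 y x ν θ := N.k22 x y θ ν

theorem PI2DK.IsContinuous.swap {p r : ℕ} {N : PI2DK p r} (hN : N.IsContinuous) :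
    N.swap.IsContinuous := by
  obtain ⟨h00, h10, h20, h01, h02, h11, h21, h12, h22⟩ := hN
  obtain ⟨N00, N10, N20, N01, N02, N11, N21, N12, N22⟩ := N
  simp only at h00 h10 h20 h01 h02 h11 h21 h12 h22
  simp only [PI2DK.swap, PI2DK.IsContinuous]
  refine ⟨?_, ?_, ?_, ?_, ?_, ?_, ?_, ?_, ?_⟩ <;> fun_prop

theorem PI2DK.IsContinuous.PI2D_swap {p r : ℕ} {N : PI2DK p r} (hN : N.IsContinuous)
    {u : ℝ → ℝ → Fin r → ℝ} (hu : Continuous fun q : ℝ × ℝ => u q.1 q.2) (a b c d x y : ℝ) :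
    PI2D c d a b N.swap (fun y x => u x y) y x = PI2D a b c d N u x y := by
  obtain ⟨h00, h10, h20, h01, h02, h11, h21, h12, h22⟩ := hN
  obtain ⟨N00, N10, N20, N01, N02, N11, N21, N12, N22⟩ := N
  simp only at h00 h10 h20 h01 h02 h11 h21 h12 h22
  simp only [PI2DK.swap, PI2D]
  rw [Continuous.intervalIntegral_swap (by fun_prop) c y a x,
    Continuous.intervalIntegral_swap (by fun_prop) c y x b,
    Continuous.intervalIntegral_swap (by fun_prop) y d a x,
    Continuous.intervalIntegral_swap (by fun_prop) y d x b]
  abel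

end Swap

theorem exists_PI2Dto011_comp_PI2D {n0 n1 p m : ℕ} {a b c d : ℝ} (hab : a ≤ b) (hcd : c ≤ d)
    {D : PI2Dto011K n0 n1 p} {N : PI2DK p m} (hD : D.IsContinuous) (hN : N.IsContinuous) :
    ∃ S : PI2Dto011K n0 n1 m, S.IsContinuous ∧
      ∀ u : ℝ → ℝ → Fin m → ℝ, (Continuous fun q : ℝ × ℝ => u q.1 q.2) →
        (PI2Dto011 a b c d D (PI2D a b c d N u)).1 = (PI2Dto011 a b c d S u).1 ∧
        (∀ x ∈ Icc a b, (PI2Dto011 a b c d D (PI2D a b c d N u)).2.1 x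
          = (PI2Dto011 a b c d S u).2.1 x) ∧
        (∀ y ∈ Icc c d, (PI2Dto011 a b c d D (PI2D a b c d N u)).2.2 y
          = (PI2Dto011 a b c d S u).2.2 y) := by
  obtain ⟨h0, h10, h11, h12, h20, h21, h22⟩ := hD
  obtain ⟨D0, D10, D11, D12, D20, D21, D22⟩ := D
  simp only at h0 h10 h11 h12 h20 h21 h22
  obtain ⟨A0, A1, A2, hA0, hA1, hA2, eA⟩ := exists_kernel_comp_PI2D (a := a) (b := b) hcd
    (D1 := 0) (D2 := 0) h0 continuous_zero continuous_zero hN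
  obtain ⟨K, hK, eK⟩ := exists_kernel_functional_comp_PI1D (P := ℝ) hab
    (G := fun _ _ => (1 : Matrix (Fin n0) (Fin n0) ℝ)) (N0 := fun y x => A0 x y)
    (N1 := fun y x θ => A1 x y θ) (N2 := fun y x θ => A2 x y θ)
    (by fun_prop) (by fun_prop) (by fun_prop) (by fun_prop)
  obtain ⟨B0, B1, B2, hB0, hB1, hB2, eB⟩ := exists_kernel_comp_PI2D (a := a) (b := b) hcd
    h10 h11 h12 hN
  obtain ⟨C0, C1, C2, hC0, hC1, hC2, eC⟩ := exists_kernel_comp_PI2D (a := c) (b := d) hab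
    (D0 := fun y x => D20 x y) (D1 := fun y x ν => D21 x y ν) (D2 := fun y x ν => D22 x y ν)
    (by fun_prop) (by fun_prop) (by fun_prop) hN.swap
  refine ⟨⟨fun x y => K y x, B0, B1, B2, fun x y => C0 y x, fun x y ν => C1 y x ν,
    fun x y ν => C2 y x ν⟩, ⟨by fun_prop, hB0, hB1, hB2, by fun_prop, by fun_prop, by fun_prop⟩,
    fun u hu => ⟨?_, eB u hu, fun y hy => ?_⟩⟩
  · have eA' : ∀ x ∈ uIcc a b, ∫ y in c..d, D0 x y *ᵥ PI2D a b c d N u x y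
        = ∫ y in c..d, (A0 x y *ᵥ u x y + (∫ θ in a..x, A1 x y θ *ᵥ u θ y)
            + ∫ θ in x..b, A2 x y θ *ᵥ u θ y) := by
      intro x hx
      rw [uIcc_of_le hab] at hx
      simpa using eA u hu x hx
    have eK' := fun y => eK y (fun x => u x y) (by fun_prop)
    simp only [one_mulVec] at eK'
    simp only [PI2Dto011]
    rw [intervalIntegral.integral_congr eA', Continuous.intervalIntegral_swap (by fun_prop),
      Continuous.intervalIntegral_swap (f := fun x y => K y x *ᵥ u x y) (by fun_prop)]
    simp only [eK']
  · have := eC (fun y x => u x y) (by fun_prop) y hy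
    simp only [hN.PI2D_swap hu] at this
    exact this

section Clamp

/-- The nearest-point retraction of `ℝ` onto `[s,t]`. -/
def clamp (s t x : ℝ) : ℝ := max s (min t x)

@[fun_prop]
theorem continuous_clamp (s t : ℝ) : Continuous (clamp s t) := by
  unfold clamp
  fun_prop

theorem clamp_mem {s t : ℝ} (hst : s ≤ t) (x : ℝ) : clamp s t x ∈ Icc s t :=
  ⟨le_max_left _ _, max_le hst (min_le_left _ _)⟩

theorem clamp_of_mem {s t x : ℝ} (hx : x ∈ Icc s t) : clamp s t x = x := by
  rw [clamp, min_eq_right hx.2, max_eq_right hx.1]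

theorem intervalIntegral_congr_Icc {E : Type*} [NormedAddCommGroup E] [NormedSpace ℝ E]
    {a b s t : ℝ} {f g : ℝ → E} (hs : s ∈ Icc a b) (ht : t ∈ Icc a b)
    (h : ∀ θ ∈ Icc a b, f θ = g θ) : ∫ θ in s..t, f θ = ∫ θ in s..t, g θ :=
  intervalIntegral.integral_congr fun θ hθ => h θ (uIcc_subset_Icc hs ht hθ)

theorem ContinuousOn.comp_clamp₂ {E : Type*} [TopologicalSpace E] {a b c d : ℝ} (hab : a ≤ b)
    (hcd : c ≤ d) {f : ℝ → ℝ → E}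
    (hf : ContinuousOn (fun q : ℝ × ℝ => f q.1 q.2) (Icc a b ×ˢ Icc c d)) :
    Continuous fun q : ℝ × ℝ => f (clamp a b q.1) (clamp c d q.2) :=
  hf.comp_continuous (f := fun q : ℝ × ℝ => (clamp a b q.1, clamp c d q.2)) (by fun_prop)
    fun _ => ⟨clamp_mem hab _, clamp_mem hcd _⟩

theorem ContinuousOn.comp_clamp₃ {E : Type*} [TopologicalSpace E] {a b c d s t : ℝ} (hab : a ≤ b)
    (hcd : c ≤ d) (hst : s ≤ t) {f : ℝ → ℝ → ℝ → E}
    (hf : ContinuousOn (fun q : ℝ × ℝ × ℝ => f q.1 q.2.1 q.2.2)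
      (Icc a b ×ˢ Icc c d ×ˢ Icc s t)) :
    Continuous fun q : ℝ × ℝ × ℝ => f (clamp a b q.1) (clamp c d q.2.1) (clamp s t q.2.2) :=
  hf.comp_continuous (f := fun q : ℝ × ℝ × ℝ => (clamp a b q.1, clamp c d q.2.1, clamp s t q.2.2))
    (by fun_prop) fun _ => ⟨clamp_mem hab _, clamp_mem hcd _, clamp_mem hst _⟩

theorem ContinuousOn.comp_clamp₄ {E : Type*} [TopologicalSpace E] {a b c d : ℝ} (hab : a ≤ b)
    (hcd : c ≤ d) {f : ℝ → ℝ → ℝ → ℝ → E}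
    (hf : ContinuousOn (fun q : ℝ × ℝ × ℝ × ℝ => f q.1 q.2.1 q.2.2.1 q.2.2.2)
      (Icc a b ×ˢ Icc c d ×ˢ Icc a b ×ˢ Icc c d)) :
    Continuous fun q : ℝ × ℝ × ℝ × ℝ =>
      f (clamp a b q.1) (clamp c d q.2.1) (clamp a b q.2.2.1) (clamp c d q.2.2.2) :=
  hf.comp_continuous (f := fun q : ℝ × ℝ × ℝ × ℝ =>
      (clamp a b q.1, clamp c d q.2.1, clamp a b q.2.2.1, clamp c d q.2.2.2)) (by fun_prop)
    fun _ => ⟨clamp_mem hab _, clamp_mem hcd _, clamp_mem hab _, clamp_mem hcd _⟩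

variable {a b c d : ℝ}

/-- The extension of 2D-PI kernels from `[a,b] × [c,d]` to the plane by clamping. -/
def PI2DK.clamped {p r : ℕ} (a b c d : ℝ) (N : PI2DK p r) : PI2DK p r where
  k00 x y := N.k00 (clamp a b x) (clamp c d y)
  k10 x y θ := N.k10 (clamp a b x) (clamp c d y) (clamp a b θ)
  k20 x y θ := N.k20 (clamp a b x) (clamp c d y) (clamp a b θ)
  k01 x y ν := N.k01 (clamp a b x) (clamp c d y) (clamp c d ν)
  k02 x y ν := N.k02 (clamp a b x) (clamp c d y) (clamp c d ν)
  k11 x y θ ν := N.k11 (clamp a b x) (clamp c d y) (clamp a b θ) (clamp c d ν)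
  k21 x y θ ν := N.k21 (clamp a b x) (clamp c d y) (clamp a b θ) (clamp c d ν)
  k12 x y θ ν := N.k12 (clamp a b x) (clamp c d y) (clamp a b θ) (clamp c d ν)
  k22 x y θ ν := N.k22 (clamp a b x) (clamp c d y) (clamp a b θ) (clamp c d ν)

theorem PI2DK.IsCont.clamped {p r : ℕ} (hab : a ≤ b) (hcd : c ≤ d) {N : PI2DK p r}
    (hN : N.IsCont a b c d) : (N.clamped a b c d).IsContinuous := by
  obtain ⟨h00, h10, h20, h01, h02, h11, h21, h12, h22⟩ := hN
  exact ⟨h00.comp_clamp₂ hab hcd, h10.comp_clamp₃ hab hcd hab, h20.comp_clamp₃ hab hcd hab,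
    h01.comp_clamp₃ hab hcd hcd, h02.comp_clamp₃ hab hcd hcd, h11.comp_clamp₄ hab hcd,
    h21.comp_clamp₄ hab hcd, h12.comp_clamp₄ hab hcd, h22.comp_clamp₄ hab hcd⟩

theorem PI2D_clamped {p r : ℕ} (N : PI2DK p r) {u v : ℝ → ℝ → Fin r → ℝ}
    (huv : ∀ x ∈ Icc a b, ∀ y ∈ Icc c d, u x y = v x y) {x y : ℝ} (hx : x ∈ Icc a b)
    (hy : y ∈ Icc c d) :
    PI2D a b c d N u x y = PI2D a b c d (N.clamped a b c d) v x y := by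
  have ha : a ∈ Icc a b := left_mem_Icc.2 (hx.1.trans hx.2)
  have hb : b ∈ Icc a b := right_mem_Icc.2 (hx.1.trans hx.2)
  have hc : c ∈ Icc c d := left_mem_Icc.2 (hy.1.trans hy.2)
  have hd : d ∈ Icc c d := right_mem_Icc.2 (hy.1.trans hy.2)
  simp only [PI2D, PI2DK.clamped, clamp_of_mem hx, clamp_of_mem hy]
  iterate 8 refine congrArg₂ (· + ·) ?_ ?_
  · rw [huv x hx y hy]
  iterate 2
    · refine intervalIntegral_congr_Icc (a := a) (b := b) (by assumption) (by assumption)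
        fun θ hθ => ?_
      rw [clamp_of_mem hθ, huv θ hθ y hy]
  iterate 2
    · refine intervalIntegral_congr_Icc (a := c) (b := d) (by assumption) (by assumption)
        fun ν hν => ?_
      rw [clamp_of_mem hν, huv x hx ν hν]
  all_goals
    refine intervalIntegral_congr_Icc (a := a) (b := b) (by assumption) (by assumption)
      fun θ hθ => intervalIntegral_congr_Icc (a := c) (b := d) (by assumption) (by assumption)
      fun ν hν => ?_
    rw [clamp_of_mem hθ, clamp_of_mem hν, huv θ hθ ν hν]

/-- The extension of (2D→011)-PI kernels from `[a,b] × [c,d]` to the plane by clamping. -/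
def PI2Dto011K.clamped {p0 p1 r : ℕ} (a b c d : ℝ) (D : PI2Dto011K p0 p1 r) :
    PI2Dto011K p0 p1 r where
  d0 x y := D.d0 (clamp a b x) (clamp c d y)
  d10 x y := D.d10 (clamp a b x) (clamp c d y)
  d11 x y θ := D.d11 (clamp a b x) (clamp c d y) (clamp a b θ)
  d12 x y θ := D.d12 (clamp a b x) (clamp c d y) (clamp a b θ)
  d20 x y := D.d20 (clamp a b x) (clamp c d y)
  d21 x y ν := D.d21 (clamp a b x) (clamp c d y) (clamp c d ν)
  d22 x y ν := D.d22 (clamp a b x) (clamp c d y) (clamp c d ν)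

theorem PI2Dto011K.IsCont.clamped {p0 p1 r : ℕ} (hab : a ≤ b) (hcd : c ≤ d)
    {D : PI2Dto011K p0 p1 r} (hD : D.IsCont a b c d) : (D.clamped a b c d).IsContinuous := by
  obtain ⟨h0, h10, h11, h12, h20, h21, h22⟩ := hD
  exact ⟨h0.comp_clamp₂ hab hcd, h10.comp_clamp₂ hab hcd, h11.comp_clamp₃ hab hcd hab,
    h12.comp_clamp₃ hab hcd hab, h20.comp_clamp₂ hab hcd, h21.comp_clamp₃ hab hcd hcd,
    h22.comp_clamp₃ hab hcd hcd⟩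

theorem PI2Dto011_clamped {p0 p1 r : ℕ} (hab : a ≤ b) (hcd : c ≤ d) (D : PI2Dto011K p0 p1 r)
    {u v : ℝ → ℝ → Fin r → ℝ} (huv : ∀ x ∈ Icc a b, ∀ y ∈ Icc c d, u x y = v x y) :
    (PI2Dto011 a b c d D u).1 = (PI2Dto011 a b c d (D.clamped a b c d) v).1 ∧
    (∀ x ∈ Icc a b, (PI2Dto011 a b c d D u).2.1 x
      = (PI2Dto011 a b c d (D.clamped a b c d) v).2.1 x) ∧
    (∀ y ∈ Icc c d, (PI2Dto011 a b c d D u).2.2 y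
      = (PI2Dto011 a b c d (D.clamped a b c d) v).2.2 y) := by
  have ha : a ∈ Icc a b := left_mem_Icc.2 hab
  have hb : b ∈ Icc a b := right_mem_Icc.2 hab
  have hc : c ∈ Icc c d := left_mem_Icc.2 hcd
  have hd : d ∈ Icc c d := right_mem_Icc.2 hcd
  refine ⟨intervalIntegral_congr_Icc ha hb fun θ hθ => intervalIntegral_congr_Icc hc hd
      fun ν hν => ?_,
    fun x hx => intervalIntegral_congr_Icc hc hd fun y hy =>
      congrArg₂ (· + ·) (congrArg₂ (· + ·) ?_ (intervalIntegral_congr_Icc ha hx fun θ hθ => ?_))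
        (intervalIntegral_congr_Icc hx hb fun θ hθ => ?_),
    fun y hy => intervalIntegral_congr_Icc ha hb fun x hx =>
      congrArg₂ (· + ·) (congrArg₂ (· + ·) ?_ (intervalIntegral_congr_Icc hc hy fun ν hν => ?_))
        (intervalIntegral_congr_Icc hy hd fun ν hν => ?_)⟩ <;>
  simp only [PI2Dto011K.clamped, clamp_of_mem, *]

end Clamp

end Auxiliary

/-- Composition of a 2D-PI operator followed by a (2D→011)-PI operator
is a (2D→011)-PI operator. -/
theorem composition_2Dto011_after_2D {n0 n1 p2 m2 : ℕ} (a b c d : ℝ)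
    (hab : a < b) (hcd : c < d)
    (D : PI2Dto011K n0 n1 p2) (N : PI2DK p2 m2)
    (hD : D.IsCont a b c d) (hN : N.IsCont a b c d) :
    ∃ S : PI2Dto011K n0 n1 m2, S.IsCont a b c d ∧
      ∀ u : ℝ → ℝ → Fin m2 → ℝ,
        ContinuousOn (fun q : ℝ × ℝ => u q.1 q.2) (Icc a b ×ˢ Icc c d) →
        (PI2Dto011 a b c d D (PI2D a b c d N u)).1 = (PI2Dto011 a b c d S u).1 ∧
        (∀ x ∈ Icc a b,
          (PI2Dto011 a b c d D (PI2D a b c d N u)).2.1 x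
            = (PI2Dto011 a b c d S u).2.1 x) ∧
        (∀ y ∈ Icc c d,
          (PI2Dto011 a b c d D (PI2D a b c d N u)).2.2 y
            = (PI2Dto011 a b c d S u).2.2 y) := by
  obtain ⟨S, hS, h⟩ := exists_PI2Dto011_comp_PI2D hab.le hcd.le (hD.clamped hab.le hcd.le)
    (hN.clamped hab.le hcd.le)
  refine ⟨S, hS.isCont a b c d, fun u hu => ?_⟩
  have huv : ∀ x ∈ Icc a b, ∀ y ∈ Icc c d, u x y = u (clamp a b x) (clamp c d y) :=
    fun x hx y hy => by rw [clamp_of_mem hx, clamp_of_mem hy]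
  obtain ⟨h0, h1, h2⟩ := h (fun x y => u (clamp a b x) (clamp c d y))
    (hu.comp_clamp₂ hab.le hcd.le)
  obtain ⟨e0, e1, e2⟩ := PI2Dto011_clamped hab.le hcd.le D
    (fun x hx y hy => PI2D_clamped N huv hx hy)
  obtain ⟨f0, f1, f2⟩ := PI2Dto011_clamped hab.le hcd.le S huv
  obtain ⟨g0, g1, g2⟩ := PI2Dto011_clamped hab.le hcd.le S
    (fun x (_ : x ∈ Icc a b) y (_ : y ∈ Icc c d) => Eq.refl (u (clamp a b x) (clamp c d y)))
  refine ⟨?_, fun x hx => ?_, fun y hy => ?_⟩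
  · rw [e0, h0, g0, f0]
  · rw [e1 x hx, h1 x hx, g1 x hx, f1 x hx]
  · rw [e2 y hy, h2 y hy, g2 y hy, f2 y hy]
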